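/- Let s be a strictly increasing generalized n-series over ℤ. Fix a nonnegative integer a, and suppose there exists k ≥ 0 with s(k+1) ≠ a·s(k) + s(1). Then for all sufficiently large n, s(n+1) ≠ a·s(n) + s(1). -/

import Mathlib

/-- For a strictly increasing generalized n-series over `ℤ` and a nonnegative
integer `a`, if `s (k+1) ≠ a·s k + s 1` for some `k`, then for all sufficiently
large `n`, `s (n+1) ≠ a·s n + s 1`. -/
theorem GNS_eventually_not_linear (s : ℕ → ℤ)
    (h0 : s 0 = 0)
    (hne : ∀ n : ℕ, 0 < n → s n ≠ 0)
    (hdvd : ∀ n k : ℕ, 0 < k → k < n → s (n - k) ∣ s n - s k)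
    (hmono : StrictMono s)
    (a : ℤ) (ha : 0 ≤ a)
    (k : ℕ) (hk : s (k + 1) ≠ a * s k + s 1) :
    ∃ N : ℕ, ∀ n ≥ N, s (n + 1) ≠ a * s n + s 1 := by
  have hk0 : 0 < k := by
    rcases Nat.eq_zero_or_pos k with rfl | h
    · simp [h0] at hk
    · exact h
  have hge : ∀ m : ℕ, (m : ℤ) ≤ s m := by
    intro m
    induction m with
    | zero => simp [h0]
    | succ m ih =>
      have := hmono (Nat.lt_succ_self m)
      push_cast
      lia
  refine ⟨k + (a * s k + s 1 - s (k + 1)).natAbs + 1, fun n hn heq => hk ?_⟩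
  have h₁ : s (n - k) ∣ s n - s k := hdvd n k hk0 (by lia)
  have h₂ : s (n - k) ∣ s (n + 1) - s (k + 1) := by
    simpa using hdvd (n + 1) (k + 1) (by lia) (by lia)
  have hdiv : s (n - k) ∣ a * s k + s 1 - s (k + 1) := by
    have h := dvd_sub h₂ (h₁.mul_left a)
    rwa [heq, show a * s n + s 1 - s (k + 1) - a * (s n - s k) =
      a * s k + s 1 - s (k + 1) by ring] at h
  have hlarge := hge (n - k)
  have hzero := Int.eq_zero_of_dvd_of_natAbs_lt_natAbs hdiv (by lia)
  lia
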